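/- For every fixed μ ≥ 0, the function δ ↦ Φ(Φ⁻¹(δ) + μ) is concave on the interval (0,1), where Φ is the standard normal cumulative distribution function and Φ⁻¹ its inverse. (This is the concavity of the Gaussian receiver-operating-characteristic curve for a mean shift μ.) -/

import Mathlib

open Set

/-- The standard normal CDF Φ(x) = ∫_{−∞}^{x} (2π)^{−1/2} e^{−t²/2} dt. -/
noncomputable def stdNormalCDF (x : ℝ) : ℝ :=
  ∫ t in Set.Iic x, (Real.sqrt (2 * Real.pi))⁻¹ * Real.exp (-(t ^ 2) / 2)

/-- The inverse Φ⁻¹ of the standard normal CDF (meaningful on (0,1)). -/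
noncomputable def stdNormalCDFInv : ℝ → ℝ :=
  Function.invFun stdNormalCDF

noncomputable def phiAux (t : ℝ) : ℝ := (Real.sqrt (2 * Real.pi))⁻¹ * Real.exp (-(t ^ 2) / 2)

lemma phiAux_eq : phiAux = ProbabilityTheory.gaussianPDFReal 0 1 := by
  funext t
  simp [phiAux, ProbabilityTheory.gaussianPDFReal]

lemma phiAux_pos (t : ℝ) : 0 < phiAux t := by
  unfold phiAux
  have := Real.pi_pos
  positivity

lemma phiAux_cont : Continuous phiAux := by
  unfold phiAux
  fun_prop

lemma phiAux_int : MeasureTheory.Integrable phiAux := by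
  rw [phiAux_eq]
  exact ProbabilityTheory.integrable_gaussianPDFReal 0 1

lemma cdf_hasDerivAt (x : ℝ) : HasDerivAt stdNormalCDF (phiAux x) x := by
  have h : stdNormalCDF = fun x => stdNormalCDF 0 + ∫ t in (0:ℝ)..x, phiAux t := by
    funext y
    rw [← intervalIntegral.integral_Iic_sub_Iic phiAux_int.integrableOn phiAux_int.integrableOn]
    simp [stdNormalCDF, phiAux]
  rw [h]
  exact (intervalIntegral.integral_hasDerivAt_right phiAux_int.intervalIntegrable
    phiAux_cont.stronglyMeasurable.stronglyMeasurableAtFilter phiAux_cont.continuousAt).const_add _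

lemma cdf_eq : stdNormalCDF = ProbabilityTheory.cdf (ProbabilityTheory.gaussianReal 0 1) := by
  funext x
  rw [ProbabilityTheory.cdf_eq_real, MeasureTheory.measureReal_def,
    ProbabilityTheory.gaussianReal_apply_eq_integral 0 (by norm_num), ENNReal.toReal_ofReal,
    ← phiAux_eq]
  · rfl
  · exact MeasureTheory.integral_nonneg fun t => ProbabilityTheory.gaussianPDFReal_nonneg _ _ _

lemma cdf_strictMono : StrictMono stdNormalCDF :=
  strictMono_of_deriv_pos fun x => by
    rw [(cdf_hasDerivAt x).deriv]; exact phiAux_pos x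

lemma cdf_cont : Continuous stdNormalCDF :=
  continuous_iff_continuousAt.2 fun x => (cdf_hasDerivAt x).continuousAt

lemma cdf_mem (x : ℝ) : stdNormalCDF x ∈ Ioo (0:ℝ) 1 := by
  constructor
  · refine lt_of_le_of_lt ?_ (cdf_strictMono (sub_one_lt x))
    rw [cdf_eq]; exact ProbabilityTheory.cdf_nonneg _ _
  · refine lt_of_lt_of_le (cdf_strictMono (lt_add_one x)) ?_
    rw [cdf_eq]; exact ProbabilityTheory.cdf_le_one _ _

lemma cdf_inv {d : ℝ} (hd : d ∈ Ioo (0:ℝ) 1) : stdNormalCDF (stdNormalCDFInv d) = d := by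
  have h0 := ProbabilityTheory.tendsto_cdf_atBot (ProbabilityTheory.gaussianReal 0 1)
  have h1 := ProbabilityTheory.tendsto_cdf_atTop (ProbabilityTheory.gaussianReal 0 1)
  rw [← cdf_eq] at h0 h1
  obtain ⟨a, ha⟩ := (h0.eventually (gt_mem_nhds hd.1)).exists
  obtain ⟨b, hb⟩ := (h1.eventually (lt_mem_nhds hd.2)).exists
  exact Function.invFun_eq (mem_range_of_exists_le_of_exists_ge cdf_cont ⟨a, ha.le⟩ ⟨b, hb.le⟩)

lemma inv_cdf (x : ℝ) : stdNormalCDFInv (stdNormalCDF x) = x :=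
  Function.leftInverse_invFun cdf_strictMono.injective x

lemma inv_mono : StrictMonoOn stdNormalCDFInv (Ioo (0:ℝ) 1) := by
  intro a ha b hb h
  rw [← cdf_strictMono.lt_iff_lt, cdf_inv ha, cdf_inv hb]
  exact h

lemma inv_hasDerivAt {d : ℝ} (hd : d ∈ Ioo (0:ℝ) 1) :
    HasDerivAt stdNormalCDFInv (phiAux (stdNormalCDFInv d))⁻¹ d := by
  have hn : Ioo (0:ℝ) 1 ∈ nhds d := isOpen_Ioo.mem_nhds hd
  refine HasDerivAt.of_local_left_inverse ?_ (cdf_hasDerivAt _) (phiAux_pos _).ne' ?_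
  · refine inv_mono.continuousAt_of_image_mem_nhds hn ?_
    convert Filter.univ_mem
    exact eq_univ_of_forall fun x => ⟨_, cdf_mem x, inv_cdf x⟩
  · filter_upwards [hn] with y hy using cdf_inv hy

lemma phiAux_ratio (q m : ℝ) :
    phiAux (q + m) * (phiAux q)⁻¹ = Real.exp (-(m * q) - m ^ 2 / 2) := by
  rw [← div_eq_mul_inv, div_eq_iff (phiAux_pos q).ne']
  unfold phiAux
  rw [mul_left_comm, ← Real.exp_add]
  ring_nf

/-- Concavity of the Gaussian ROC curve: for fixed μ ≥ 0, the map
δ ↦ Φ(Φ⁻¹(δ) + μ) is concave on (0,1). -/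
theorem stmt_9 (μ : ℝ) (hμ : 0 ≤ μ) :
    ConcaveOn ℝ (Set.Ioo (0 : ℝ) 1)
      (fun δ : ℝ => stdNormalCDF (stdNormalCDFInv δ + μ)) := by
  have hD : ∀ d ∈ Ioo (0:ℝ) 1, HasDerivAt (fun δ : ℝ => stdNormalCDF (stdNormalCDFInv δ + μ))
      (Real.exp (-(μ * stdNormalCDFInv d) - μ ^ 2 / 2)) d := by
    intro d hd
    rw [← phiAux_ratio]
    exact (cdf_hasDerivAt (stdNormalCDFInv d + μ)).comp d ((inv_hasDerivAt hd).add_const μ)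
  refine AntitoneOn.concaveOn_of_deriv (convex_Ioo 0 1)
    (fun d hd => (hD d hd).continuousAt.continuousWithinAt) ?_ ?_
  · rw [interior_Ioo]
    exact fun d hd => (hD d hd).differentiableAt.differentiableWithinAt
  · rw [interior_Ioo]
    intro a ha b hb hab
    rw [(hD a ha).deriv, (hD b hb).deriv]
    have := mul_le_mul_of_nonneg_left (inv_mono.monotoneOn ha hb hab) hμ
    exact Real.exp_le_exp.2 (by linarith)
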